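/- arXiv:1204.2837 — 9 statements merged into one kernel-verified Lean document; each statement's English description precedes it below -/
import Mathlib

section
/- Let V be a type, G a simple graph on V, and T a complete lattice. For every node-weight function n : V → T and every symmetric edge-weight function e : V → V → T, the dilation δ_en and the erosion ε_ne form an adjunction: (for all adjacent vertices i, j, n i ⊔ n j ≤ e i j) if and only if (for all vertices i, n i ≤ (ε_ne e) i). -/
/-- the dilation `δ_en` (node weights to edge weights,
`(δ_en n) i j = n i ⊔ n j`) and the erosion `ε_ne` (edge weights to node weights,
`(ε_ne e) i = ⨅ over neighbors j of i of e i j`) form an adjunction. -/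
theorem flooding_adjunction_en_ne {V : Type*} (G : SimpleGraph V) {T : Type*}
    [CompleteLattice T] (n : V → T) (e : V → V → T)
    (hsym : ∀ i j, e i j = e j i) :
    (∀ i j, G.Adj i j → n i ⊔ n j ≤ e i j) ↔
      (∀ i, n i ≤ ⨅ j, ⨅ _ : G.Adj i j, e i j) := by
  simp only [le_iInf_iff, sup_le_iff]
  exact ⟨fun h i j hij => (h i j hij).1,
    fun h i j hij => ⟨h i j hij, hsym i j ▸ h j i hij.symm⟩⟩
end

section
/- Let V be a type, G a simple graph on V, T a complete linear order, and e : V → V → T a symmetric edge-weight function. Write m i = (ε_ne e) i for the infimum of the weights of the edges adjacent to i. Then an adjacent pair (i, j) is invariant under the opening γ_e = δ_en ∘ ε_ne, i.e. m i ⊔ m j = e i j, if and only if the edge (i, j) is a lowest adjacent edge of one of its extremities, i.e. e i j = m i or e i j = m j. -/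
/-- an adjacent pair `(i, j)` is invariant under the opening
`γ_e = δ_en ∘ ε_ne` iff the edge `(i, j)` is a lowest adjacent edge of one of
its extremities.  Here `m i = (ε_ne e) i` is the infimum of the weights of the
edges adjacent to `i`. -/
theorem invariant_opening_iff_lowest_edge {V : Type*} (G : SimpleGraph V)
    {T : Type*} [CompleteLinearOrder T] (e : V → V → T)
    (hsym : ∀ i j, e i j = e j i) (i j : V) (hij : G.Adj i j) :
    (⨅ k, ⨅ _ : G.Adj i k, e i k) ⊔ (⨅ k, ⨅ _ : G.Adj j k, e j k) = e i j ↔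
      (e i j = ⨅ k, ⨅ _ : G.Adj i k, e i k) ∨
        (e i j = ⨅ k, ⨅ _ : G.Adj j k, e j k) := by
  have hi : (⨅ k, ⨅ _ : G.Adj i k, e i k) ≤ e i j := iInf₂_le j hij
  have hj : (⨅ k, ⨅ _ : G.Adj j k, e j k) ≤ e i j :=
    (iInf₂_le i hij.symm).trans_eq (hsym j i)
  constructor
  · intro h
    rcases max_choice (⨅ k, ⨅ _ : G.Adj i k, e i k) (⨅ k, ⨅ _ : G.Adj j k, e j k) with h' | h'
    · exact Or.inl (h.symm.trans h')
    · exact Or.inr (h.symm.trans h')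
  · rintro (h | h)
    · exact le_antisymm (sup_le hi hj) (h.le.trans le_sup_left)
    · exact le_antisymm (sup_le hi hj) (h.le.trans le_sup_right)
end

section
/- Let V be a type, G a simple graph on V, T a complete linear order, and n : V → T a node-weight function. Let φ_n n = ε_ne(δ_en n), so (φ_n n) i is the infimum over the neighbors j of i of n i ⊔ n j. Then: (a) if some neighbor j of i satisfies n j ≤ n i, then (φ_n n) i = n i; (b) if every neighbor j of i satisfies n i < n j (i is an isolated regional minimum), then (φ_n n) i equals the infimum of n j over the neighbors j of i. Thus the closing φ_n replaces each isolated regional minimum by the infimum of its neighboring node weights and leaves all other nodes unchanged. -/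
/-- the closing `φ_n = ε_ne ∘ δ_en` on node weights,
`(φ_n n) i = ⨅ over neighbors j of i of (n i ⊔ n j)`, replaces each isolated
regional minimum by the infimum of its neighboring node weights and leaves all
other nodes unchanged. -/
theorem closing_phi_n_characterization {V : Type*} (G : SimpleGraph V)
    {T : Type*} [CompleteLinearOrder T] (n : V → T) (i : V) :
    ((∃ j, G.Adj i j ∧ n j ≤ n i) →
        (⨅ j, ⨅ _ : G.Adj i j, n i ⊔ n j) = n i) ∧
    ((∀ j, G.Adj i j → n i < n j) →
        (⨅ j, ⨅ _ : G.Adj i j, n i ⊔ n j) = ⨅ j, ⨅ _ : G.Adj i j, n j) := by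
  refine ⟨fun ⟨j, hij, hj⟩ => le_antisymm ?_ ?_, fun h => ?_⟩
  · exact (iInf₂_le j hij).trans_eq (sup_eq_left.mpr hj)
  · exact le_iInf₂ fun _ _ => le_sup_left
  · exact iInf_congr fun j => iInf_congr fun hij => sup_eq_right.mpr (h j hij).le
end

section
/- Let V be a finite type, G a simple graph on V in which every vertex has at least one neighbor, T a complete linear order, and e : V → V → T a symmetric edge-weight function. Write m i = (ε_ne e) i for the infimum of the weights of the edges adjacent to i. For each vertex i, the set of neighbors j of i such that the edge (i, j) is a lowest adjacent edge of one of its extremities (i.e. e i j = m i or e i j = m j) is nonempty, and the infimum of e i j over this set equals m i. In other words, the erosion ε_ne computed on the pruned graph ↓G, which keeps for each node only its lowest adjacent edges, coincides with the erosion ε_ne computed on G. -/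
/-- in a finite graph where every vertex has a neighbor, the
erosion `ε_ne` computed on the pruned graph `↓G` (keeping for each node only
the edges that are a lowest adjacent edge of one of their extremities)
coincides with the erosion computed on `G`.  Here `m i = (ε_ne e) i`. -/
theorem erosion_on_pruned_graph {V : Type*} [Fintype V] (G : SimpleGraph V)
    (hnb : ∀ i : V, ∃ j, G.Adj i j) {T : Type*} [CompleteLinearOrder T]
    (e : V → V → T) (hsym : ∀ i j, e i j = e j i)
    (m : V → T) (hm : ∀ i, m i = ⨅ j, ⨅ _ : G.Adj i j, e i j) (i : V) :
    (∃ j, G.Adj i j ∧ (e i j = m i ∨ e i j = m j)) ∧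
      (⨅ j, ⨅ _ : G.Adj i j ∧ (e i j = m i ∨ e i j = m j), e i j) = m i := by
  obtain ⟨j, hj, hmin⟩ := Set.exists_min_image {j | G.Adj i j} (e i) (Set.toFinite _) (hnb i)
  have hej : e i j = m i := by
    rw [hm]
    exact le_antisymm (le_iInf₂ hmin) (iInf₂_le j hj)
  refine ⟨⟨j, hj, Or.inl hej⟩, le_antisymm ?_ ?_⟩
  · exact (iInf₂_le j ⟨hj, Or.inl hej⟩).trans_eq hej
  · rw [← hej]
    exact le_iInf₂ fun k hk => hmin k hk.1
end

section
/- Let V be a finite type, G a simple graph on V in which every vertex has at least one neighbor, T a complete linear order, and e : V → V → T a symmetric edge-weight function that is invariant under the opening γ_e = δ_en ∘ ε_ne, i.e. for all adjacent i, j one has e i j = (ε_ne e) i ⊔ (ε_ne e) j. Let n = ε_ne e. Then the regional minima of the edge-weighted graph (e) span exactly the regional minima of the node-weighted graph (n): a vertex v belongs to a regional minimum of the node weights n if and only if v is an endpoint of some adjacent pair lying in a regional minimum of the edge weights e. -/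
/-- A vertex `i` belongs to a regional minimum of node weights `n`: for every
vertex `v` reachable from `i` by a walk all of whose vertices have weight
`n i`, every neighbor `w` of `v` satisfies `n i ≤ n w`. -/
def NodeRegMin {V : Type*} {T : Type*} [LinearOrder T] (G : SimpleGraph V)
    (n : V → T) (i : V) : Prop :=
  ∀ v : V, (∃ p : G.Walk i v, ∀ x ∈ p.support, n x = n i) →
    ∀ w, G.Adj v w → n i ≤ n w

/-- An adjacent pair `{i, j}` belongs to a regional minimum of edge weights
`e`: for every vertex `v` in the connected component of `i` of the spanning
subgraph of `G` whose edges are the edges of weight `e i j`, every edge of `G`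
incident to `v` has weight at least `e i j`. -/
def EdgeRegMin {V : Type*} {T : Type*} [LinearOrder T] (G : SimpleGraph V)
    (e : V → V → T) (i j : V) : Prop :=
  G.Adj i j ∧
    ∀ v : V, (∃ p : G.Walk i v, ∀ d ∈ p.darts, e d.fst d.snd = e i j) →
      ∀ w, G.Adj v w → e i j ≤ e v w

theorem NodeRegMin.of_adj {V T : Type*} [LinearOrder T] {G : SimpleGraph V} {n : V → T}
    {a b : V} (h : NodeRegMin G n a) (hab : G.Adj a b) (hb : n b = n a) : NodeRegMin G n b := by
  rintro v ⟨p, hp⟩ w hw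
  rw [hb]
  refine h v ⟨.cons hab p, fun x hx => ?_⟩ w hw
  rw [SimpleGraph.Walk.support_cons, List.mem_cons] at hx
  rcases hx with rfl | hx
  · rfl
  · rw [hp x hx, hb]

theorem NodeRegMin.eq_of_walk {V T : Type*} [LinearOrder T] {G : SimpleGraph V}
    {e : V → V → T} {n : V → T} (hinv : ∀ i j, G.Adj i j → e i j = n i ⊔ n j) {a u : V}
    (p : G.Walk a u) (h : NodeRegMin G n a) (hp : ∀ d ∈ p.darts, e d.fst d.snd = n a) :
    n u = n a := by
  induction p with
  | nil => rfl
  | @cons a b u hab q ih =>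
    simp only [SimpleGraph.Walk.darts_cons, List.mem_cons, forall_eq_or_imp] at hp
    have hb : n b = n a := by
      refine le_antisymm ?_ (h a ⟨.nil, by simp⟩ b hab)
      rw [← hp.1, hinv a b hab]
      exact le_sup_right
    rw [← hb]
    exact ih (h.of_adj hab hb) fun d hd => (hp.2 d hd).trans hb.symm

theorem EdgeRegMin.symm {V T : Type*} [LinearOrder T] {G : SimpleGraph V} {e : V → V → T}
    (hsym : ∀ i j, e i j = e j i) {i j : V} (h : EdgeRegMin G e i j) : EdgeRegMin G e j i := by
  refine ⟨h.1.symm, ?_⟩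
  rintro v ⟨p, hp⟩ w hw
  rw [hsym j i] at hp ⊢
  exact h.2 v ⟨.cons h.1 p, by simpa using hp⟩ w hw

theorem EdgeRegMin.nodeRegMin {V T : Type*} [LinearOrder T] {G : SimpleGraph V}
    {e : V → V → T} {n : V → T} (hn : ∀ i c, (∀ j, G.Adj i j → c ≤ e i j) → c ≤ n i)
    (hinv : ∀ i j, G.Adj i j → e i j = n i ⊔ n j) {i j : V} (h : EdgeRegMin G e i j) :
    NodeRegMin G n i := by
  have hi : n i = e i j := by
    refine le_antisymm ?_ (hn i _ (h.2 i ⟨.nil, by simp⟩))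
    rw [hinv i j h.1]
    exact le_sup_left
  rintro v ⟨p, hp⟩ w hw
  by_contra! hlt
  have hv : n v = n i := hp v p.end_mem_support
  have hvw : e v w = e i j := by rw [hinv v w hw, hv, sup_eq_left.2 hlt.le, hi]
  refine hlt.not_ge (hi ▸ hn w _ (h.2 w ⟨p.concat hw, fun d hd => ?_⟩))
  rw [SimpleGraph.Walk.darts_concat, List.concat_eq_append, List.mem_append,
    List.mem_singleton] at hd
  rcases hd with hd | rfl
  · rw [hinv _ _ d.adj, hp _ (p.dart_fst_mem_support_of_mem_darts hd),
      hp _ (p.dart_snd_mem_support_of_mem_darts hd), sup_idem, hi]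
  · exact hvw

/-- if the edge weights `e` are invariant under the opening
`γ_e = δ_en ∘ ε_ne` and `n = ε_ne e`, then the regional minima of the edge
weighted graph span exactly the regional minima of the node weighted graph. -/
theorem regional_minima_invariant_opening {V : Type*} [Fintype V]
    (G : SimpleGraph V) (hnb : ∀ i : V, ∃ j, G.Adj i j) {T : Type*}
    [CompleteLinearOrder T] (e : V → V → T) (hsym : ∀ i j, e i j = e j i)
    (n : V → T) (hn : ∀ i, n i = ⨅ j, ⨅ _ : G.Adj i j, e i j)
    (hinv : ∀ i j, G.Adj i j → e i j = n i ⊔ n j) (v : V) :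
    NodeRegMin G n v ↔ ∃ i j, EdgeRegMin G e i j ∧ (v = i ∨ v = j) := by
  have hle : ∀ i j, G.Adj i j → n i ≤ e i j := fun i j hij => by
    rw [hinv i j hij]
    exact le_sup_left
  have hge : ∀ i c, (∀ j, G.Adj i j → c ≤ e i j) → c ≤ n i := fun i c hc => by
    rw [hn i]
    exact le_iInf₂ hc
  constructor
  · intro h
    obtain ⟨w, hw, hmin⟩ :=
      Set.exists_min_image (G.neighborSet v) (e v) (Set.toFinite _) (hnb v)
    have hvw : e v w = n v := le_antisymm (hge v _ hmin) (hle v w hw)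
    refine ⟨v, w, ⟨hw, ?_⟩, .inl rfl⟩
    rintro u ⟨p, hp⟩ x hx
    rw [hvw] at hp ⊢
    exact (h.eq_of_walk hinv p hp).ge.trans (hle u x hx)
  · rintro ⟨i, j, h, rfl | rfl⟩
    · exact h.nodeRegMin hge hinv
    · exact (h.symm hsym).nodeRegMin hge hinv
end

section
/- Let V be a finite type, G a simple graph on V in which every vertex has at least one neighbor, T a complete linear order, and n : V → T a node-weight function invariant under the closing φ_n = ε_ne ∘ δ_en, i.e. for every vertex i, n i equals the infimum over the neighbors j of i of n i ⊔ n j. Then G has no isolated regional minima: every vertex i has a neighbor j with n j ≤ n i. -/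
/-- if the node weights `n` are invariant under the closing
`φ_n = ε_ne ∘ δ_en`, then the graph has no isolated regional minima: every
vertex has a neighbor with a lower or equal weight. -/
theorem invariant_closing_no_isolated_minima {V : Type*} [Fintype V]
    (G : SimpleGraph V) (hnb : ∀ i : V, ∃ j, G.Adj i j) {T : Type*}
    [CompleteLinearOrder T] (n : V → T)
    (hinv : ∀ i, n i = ⨅ j, ⨅ _ : G.Adj i j, n i ⊔ n j) :
    ∀ i : V, ∃ j, G.Adj i j ∧ n j ≤ n i := by
  intro i
  obtain ⟨j₀, hj₀⟩ := hnb i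
  have : Nonempty {j // G.Adj i j} := ⟨⟨j₀, hj₀⟩⟩
  obtain ⟨⟨j, hj⟩, hmin⟩ :=
    exists_eq_ciInf_of_finite (f := fun j : {j // G.Adj i j} => n i ⊔ n j)
  refine ⟨j, hj, le_sup_right.trans (hmin.trans ?_).le⟩
  rw [iInf_subtype]
  exact (hinv i).symm
end

section
/- Let V be a finite type, G a simple graph on V, T a linear order, and n : V → T a node-weight function. Then from every vertex there starts a never ascending path to a regional minimum: for every vertex i there exists a walk i = x₀, x₁, …, x_k in G with n x_{t+1} ≤ n x_t for all 0 ≤ t < k, such that x_k belongs to a regional minimum of n. -/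
/-- in a finite node weighted graph, from every vertex starts a
never ascending walk leading to a regional minimum. -/
theorem never_ascending_path_to_regional_minimum {V : Type*} [Fintype V]
    (G : SimpleGraph V) {T : Type*} [LinearOrder T] (n : V → T) (i : V) :
    ∃ (v : V) (p : G.Walk i v),
      (∀ d ∈ p.darts, n d.snd ≤ n d.fst) ∧ NodeRegMin G n v := by
  obtain ⟨v, ⟨p, hp⟩, hmin⟩ := Set.exists_min_image
    {v | ∃ p : G.Walk i v, ∀ d ∈ p.darts, n d.snd ≤ n d.fst} n (Set.toFinite _)
    ⟨i, .nil, by simp⟩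
  refine ⟨v, p, hp, fun u ⟨q, hq⟩ w huw => ?_⟩
  by_contra! hlt
  refine hlt.not_ge (hmin w ⟨(p.append q).concat huw, fun d hd => ?_⟩)
  simp only [SimpleGraph.Walk.darts_concat, SimpleGraph.Walk.darts_append, List.concat_eq_append,
    List.mem_append, List.mem_singleton] at hd
  rcases hd with (hd | hd) | rfl
  · exact hp d hd
  · rw [hq _ (q.dart_fst_mem_support_of_mem_darts hd),
      hq _ (q.dart_snd_mem_support_of_mem_darts hd)]
  · exact hlt.le.trans_eq (hq u q.end_mem_support).symm
end

section
/- Let V be a finite type, G a simple graph on V, and n : V → ℝ a node-weight function. Define the node erosion ε n : V → ℝ by (ε n) i = min(n i, minimum of n j over the neighbors j of i) (with (ε n) i = n i if i has no neighbor). Then for every walk x₀, x₁, …, x_p in G, the topographic length of the walk bounds the final altitude: n x_p ≤ n x₀ + ∑_{k=1}^{p} (n x_k − (ε n) x_k). -/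
open Finset

/-- The node erosion: `(nodeErosion G n) i` is the minimum of `n i` and of the
weights of the neighbors of `i` (equal to `n i` if `i` has no neighbor). -/
noncomputable def nodeErosion {V : Type*} [Fintype V] [DecidableEq V] (G : SimpleGraph V)
    [DecidableRel G.Adj] (n : V → ℝ) (i : V) : ℝ :=
  (insert i (G.neighborFinset i)).inf' (insert_nonempty i _) n

/-- The erosion at a vertex is at most the weight of each of its neighbors. -/
theorem nodeErosion_le_of_adj {V : Type*} [Fintype V] [DecidableEq V] (G : SimpleGraph V)
    [DecidableRel G.Adj] (n : V → ℝ) {i j : V} (h : G.Adj i j) : nodeErosion G n i ≤ n j :=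
  inf'_le n (mem_insert_of_mem ((G.mem_neighborFinset i j).2 h))

/-- for every walk `x₀, …, x_p`, the topographic length
`n x₀ + ∑_{k=1}^p (n x_k − (ε n) x_k)` bounds the final altitude `n x_p`. -/
theorem topographic_length_bounds_altitude {V : Type*} [Fintype V] [DecidableEq V]
    (G : SimpleGraph V) [DecidableRel G.Adj] (n : V → ℝ) (u v : V)
    (p : G.Walk u v) :
    n v ≤ n u + (p.darts.map (fun d => n d.snd - nodeErosion G n d.snd)).sum := by
  induction p with
  | nil => simp
  | cons h p ih =>
    have hle := nodeErosion_le_of_adj G n h.symm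
    simp only [SimpleGraph.Walk.darts_cons, List.map_cons, List.sum_cons]
    linarith
end

section
/- Let V be a finite type, G a simple graph on V in which every vertex has at least one neighbor, T a complete linear order, and let (e, n) be the weights of a flooding graph: e : V → V → T is a symmetric edge-weight function and n : V → T a node-weight function with e i j = n i ⊔ n j for all adjacent i, j, and n i equal to the infimum of e i j over the neighbors j of i, for all i. Then every vertex i has a neighbor j with n j ≤ n i, and for every such neighbor j the connecting edge carries the weight of i: e i j = n i; consequently every edge linking a node to a lower-or-equal neighboring node is a lowest adjacent edge of that node. -/
/-- in a flooding graph (`δ_en n = e` and `ε_ne e = n`), every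
vertex `i` has a neighbor `j` with `n j ≤ n i`, and every edge linking `i` to a
lower-or-equal neighboring node carries the weight `n i`, i.e. is a lowest
adjacent edge of `i`. -/
theorem flooding_graph_lowest_adjacent_edges {V : Type*} [Fintype V]
    (G : SimpleGraph V) (hnb : ∀ i : V, ∃ j, G.Adj i j) {T : Type*}
    [CompleteLinearOrder T] (e : V → V → T) (hsym : ∀ i j, e i j = e j i)
    (n : V → T) (hde : ∀ i j, G.Adj i j → e i j = n i ⊔ n j)
    (hen : ∀ i, n i = ⨅ j, ⨅ _ : G.Adj i j, e i j) (i : V) :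
    (∃ j, G.Adj i j ∧ n j ≤ n i) ∧
      ∀ j, G.Adj i j → n j ≤ n i →
        e i j = n i ∧ e i j = ⨅ k, ⨅ _ : G.Adj i k, e i k := by
  constructor
  · obtain ⟨j, hj, hmin⟩ :=
      Set.exists_min_image {j | G.Adj i j} (e i) (Set.toFinite _) (hnb i)
    have hle : e i j ≤ n i := by
      rw [hen i]
      exact le_iInf₂ hmin
    refine ⟨j, hj, le_trans ?_ hle⟩
    rw [hde i j hj]
    exact le_sup_right
  · intro j hj hji
    have heq : e i j = n i := by rw [hde i j hj, sup_eq_left.mpr hji]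
    exact ⟨heq, heq.trans (hen i)⟩
end
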